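/- arXiv:2501.06018 — 9 statements merged into one kernel-verified Lean document; each statement's English description precedes it below -/
import Mathlib

section
/- Let K be a finite field, κ an infinite cardinal, and (R_α)_{α<κ} a family of K-algebras. Let P = ∏_{α<κ} R_α and let I be the ideal of P consisting of all finitely supported elements. Let R be a subring of P containing I and suppose π : R → K is a surjective ring homomorphism with kernel I. Then π splits: there exists a ring homomorphism ν : K → R with π ∘ ν = id_K (so R is a semidirect product of I and K). -/
/-- Let `K` be a finite field, `κ` an infinite cardinal (here an infinite
index type `ι`), and `(R_α)_{α<κ}` a family of `K`-algebras. Let `P = ∏ α, R α` and let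
`I` be the ideal of finitely supported elements of `P`. If `R` is a subring of `P`
containing `I` and `π : R → K` is a surjective ring homomorphism with kernel `I`, then `π`
splits: there is a ring homomorphism `ν : K → R` with `π ∘ ν = id_K`. -/
theorem splits_of_finite_field
    (K : Type*) [Field K] [Finite K] {ι : Type*} [Infinite ι] (A : ι → Type*)
    [∀ i, Ring (A i)] [∀ i, Algebra K (A i)]
    (R : Subring (∀ i, A i))
    (hIR : ∀ p : ∀ i, A i, {i | p i ≠ 0}.Finite → p ∈ R)
    (π : R →+* K) (hsurj : Function.Surjective π)
    (hker : ∀ x : R, π x = 0 ↔ {i | (x : ∀ i, A i) i ≠ 0}.Finite) :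
    ∃ ν : K →+* R, π.comp ν = RingHom.id K := by
  classical
  choose s hs using hsurj
  have finite_ne : ∀ x y : R, π x = π y →
      {i | (x : ∀ i, A i) i ≠ (y : ∀ i, A i) i}.Finite := fun x y h ↦ by
    have hfin := (hker (x - y)).1 (by rw [map_sub, h, sub_self])
    simpa [sub_eq_zero] using hfin
  -- The coordinates where the section `s` fails to be a ring homomorphism.
  let F : Set ι := {i | (s 1 : ∀ i, A i) i ≠ ((1 : R) : ∀ i, A i) i} ∪
    ((⋃ ab : K × K, {i | (s (ab.1 + ab.2) : ∀ i, A i) i ≠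
      ((s ab.1 + s ab.2 : R) : ∀ i, A i) i}) ∪
    ⋃ ab : K × K, {i | (s (ab.1 * ab.2) : ∀ i, A i) i ≠
      ((s ab.1 * s ab.2 : R) : ∀ i, A i) i})
  have hF : F.Finite :=
    (finite_ne _ _ (by simp [hs])).union
      ((Set.finite_iUnion fun _ ↦ finite_ne _ _ (by simp [hs])).union
        (Set.finite_iUnion fun _ ↦ finite_ne _ _ (by simp [hs])))
  have h_one : ∀ i ∉ F, (s 1 : ∀ i, A i) i = 1 := fun i hi ↦ by
    by_contra h
    exact hi (Or.inl h)
  have h_add : ∀ i ∉ F, ∀ a b, (s (a + b) : ∀ i, A i) i =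
      (s a : ∀ i, A i) i + (s b : ∀ i, A i) i := fun i hi a b ↦ by
    by_contra h
    exact hi (Or.inr (Or.inl (Set.mem_iUnion.2 ⟨(a, b), h⟩)))
  have h_mul : ∀ i ∉ F, ∀ a b, (s (a * b) : ∀ i, A i) i =
      (s a : ∀ i, A i) i * (s b : ∀ i, A i) i := fun i hi a b ↦ by
    by_contra h
    exact hi (Or.inr (Or.inr (Set.mem_iUnion.2 ⟨(a, b), h⟩)))
  have h_zero : ∀ i ∉ F, (s 0 : ∀ i, A i) i = 0 := fun i hi ↦ by
    simpa using h_add i hi 0 0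
  let g : K →+* ∀ i, A i :=
    { toFun := fun a i ↦ if i ∈ F then algebraMap K (A i) a else (s a : ∀ i, A i) i
      map_one' := by
        funext i
        by_cases hi : i ∈ F <;> simp [hi, h_one]
      map_zero' := by
        funext i
        by_cases hi : i ∈ F <;> simp [hi, h_zero]
      map_add' := fun a b ↦ by
        funext i
        by_cases hi : i ∈ F <;> simp [hi, h_add]
      map_mul' := fun a b ↦ by
        funext i
        by_cases hi : i ∈ F <;> simp [hi, h_mul] }
  have hg : ∀ a, {i | (g a - s a) i ≠ 0}.Finite := fun a ↦
    hF.subset fun i hi ↦ by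
      by_contra h
      exact hi (by simp [g, h])
  have hgR : ∀ a, g a ∈ R := fun a ↦ by
    simpa using R.add_mem (hIR _ (hg a)) (s a).2
  refine ⟨g.codRestrict R hgR, RingHom.ext fun a ↦ ?_⟩
  have h := (hker (g.codRestrict R hgR a - s a)).2 (hg a)
  rw [map_sub, hs, sub_eq_zero] at h
  exact h
end

section
/- Let K be a field of characteristic p > 0 that is not perfect (i.e. the Frobenius map x ↦ x^p is not surjective on K), and let κ be an infinite cardinal. Let R be the subring of K^κ consisting of all functions f : κ → K for which there exists c ∈ K with f(α) = c^p for all but finitely many α < κ. Then there is no ring isomorphism between R(κ,K) and R. -/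
/-- The `K`-subalgebra `R(κ,K)` of `K^κ` consisting of all eventually constant functions:
all `f : ι → K` such that for some `c ∈ K`, `f a = c` for all but finitely many `a`. -/
def Rconst (K ι : Type*) [Field K] : Subalgebra K (ι → K) where
  carrier := {f | ∃ c : K, {a | f a ≠ c}.Finite}
  mul_mem' := by
    rintro f g ⟨c, hc⟩ ⟨d, hd⟩
    refine ⟨c * d, (hc.union hd).subset fun a ha => ?_⟩
    by_contra h
    simp only [Set.mem_union, Set.mem_setOf_eq, not_or, not_not] at h
    exact ha (show (f * g) a = _ by rw [Pi.mul_apply, h.1, h.2])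
  add_mem' := by
    rintro f g ⟨c, hc⟩ ⟨d, hd⟩
    refine ⟨c + d, (hc.union hd).subset fun a ha => ?_⟩
    by_contra h
    simp only [Set.mem_union, Set.mem_setOf_eq, not_or, not_not] at h
    exact ha (show (f + g) a = _ by rw [Pi.add_apply, h.1, h.2])
  algebraMap_mem' := fun c => ⟨c, by simp [Set.finite_empty]⟩

/-- The subring of `K^κ` of all functions that are eventually equal to a constant lying in
the subring `S ≤ K`. -/
def RconstS (K ι : Type*) [Field K] (S : Subring K) : Subring (ι → K) where
  carrier := {f | ∃ c ∈ S, {a | f a ≠ c}.Finite}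
  mul_mem' := by
    rintro f g ⟨c, hcS, hc⟩ ⟨d, hdS, hd⟩
    refine ⟨c * d, S.mul_mem hcS hdS, (hc.union hd).subset fun a ha => ?_⟩
    by_contra h
    simp only [Set.mem_union, Set.mem_setOf_eq, not_or, not_not] at h
    exact ha (show (f * g) a = _ by rw [Pi.mul_apply, h.1, h.2])
  add_mem' := by
    rintro f g ⟨c, hcS, hc⟩ ⟨d, hdS, hd⟩
    refine ⟨c + d, S.add_mem hcS hdS, (hc.union hd).subset fun a ha => ?_⟩
    by_contra h
    simp only [Set.mem_union, Set.mem_setOf_eq, not_or, not_not] at h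
    exact ha (show (f + g) a = _ by rw [Pi.add_apply, h.1, h.2])
  neg_mem' := by
    rintro f ⟨c, hcS, hc⟩
    refine ⟨-c, S.neg_mem hcS, hc.subset fun a ha => ?_⟩
    by_contra h
    simp only [Set.mem_setOf_eq, not_not] at h
    exact ha (show (-f) a = -c by rw [Pi.neg_apply, h])
  one_mem' := ⟨1, S.one_mem, by simp⟩
  zero_mem' := ⟨0, S.zero_mem, by simp⟩

/-- The function supported at `i` with value `c` is eventually zero. -/
theorem single_mem_RconstS {K ι : Type*} [Field K] [DecidableEq ι] (S : Subring K) (i : ι)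
    (c : K) : Pi.single i c ∈ RconstS K ι S := by
  refine ⟨0, S.zero_mem, (Set.finite_singleton i).subset fun a ha => ?_⟩
  by_contra h
  exact ha (by simp [show a ≠ i from h])

/-- Let `K` be a field of characteristic `p > 0` which is not perfect
(the Frobenius `x ↦ x^p` is not surjective), and let `κ` be an infinite cardinal (here an
infinite index type `ι`). Let `R` be the subring of `K^κ` of functions eventually equal to
`c^p` for some `c ∈ K`. Then `R(κ,K)` and `R` are not isomorphic as rings. -/
theorem not_iso_of_not_perfect
    (K ι : Type*) [Field K] [Infinite ι] (p : ℕ) [Fact p.Prime] [CharP K p]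
    (hnp : ¬ Function.Surjective (frobenius K p)) :
    IsEmpty (Rconst K ι ≃+* RconstS K ι (frobenius K p).range) := by
  classical
  refine ⟨fun φ => hnp fun a => ?_⟩
  let f : Rconst K ι := algebraMap K _ a
  obtain ⟨c, ⟨b, hb⟩, hc⟩ := (φ f).2
  obtain ⟨i, hi⟩ := hc.exists_notMem
  have hi : (φ f).1 i = b ^ p := by
    rw [Set.mem_ofPred_eq, not_not] at hi
    rw [hi, ← hb, frobenius_def]
  let e : RconstS K ι (frobenius K p).range := ⟨Pi.single i 1, single_mem_RconstS _ i 1⟩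
  let g : RconstS K ι (frobenius K p).range := ⟨Pi.single i b, single_mem_RconstS _ i b⟩
  have hg : g ^ p = φ f * e := by
    ext j
    change (Pi.single i b : ι → K) j ^ p = (φ f).1 j * (Pi.single i 1 : ι → K) j
    obtain rfl | hj := eq_or_ne j i
    · simp [hi]
    · simp [hj, (Fact.out : p.Prime).ne_zero]
  have he : e * e = e := by
    ext j
    change (Pi.single i 1 : ι → K) j * (Pi.single i 1 : ι → K) j = (Pi.single i 1 : ι → K) j
    obtain rfl | hj := eq_or_ne j i <;> simp [*]
  have he0 : e ≠ 0 := fun h => by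
    have h' : (Pi.single i 1 : ι → K) i = 0 := congrFun (congrArg Subtype.val h) i
    simp at h'
  have hg' : φ.symm g ^ p = f * φ.symm e := by
    rw [← map_pow, hg, map_mul, φ.symm_apply_apply]
  have he' : φ.symm e * φ.symm e = φ.symm e := by rw [← map_mul, he]
  obtain ⟨j, hj⟩ : ∃ j, (φ.symm e).1 j ≠ 0 := by
    by_contra! h
    exact he0 (φ.symm.map_eq_zero_iff.mp (Subtype.ext (funext h)))
  have hej : (φ.symm e).1 j * (φ.symm e).1 j = (φ.symm e).1 j :=
    congrFun (congrArg Subtype.val he') j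
  have hgj : (φ.symm g).1 j ^ p = a * (φ.symm e).1 j :=
    congrFun (congrArg Subtype.val hg') j
  refine ⟨(φ.symm g).1 j, ?_⟩
  rw [frobenius_def, hgj, mul_right_cancel₀ hj (hej.trans (one_mul _).symm), mul_one]
end

section
/- Let K′ ⊆ K be fields (so K is a K′-algebra via the inclusion). If K possesses a multiplicative K′-basis, i.e. a K′-vector space basis B of K such that for all b, b′ ∈ B either b·b′ = 0 or b·b′ ∈ B, then K′ = K (the inclusion K′ → K is surjective). -/
/-- Let `K′ ⊆ K` be fields. If `K` possesses a multiplicative `K′`-basis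
`B` (a `K′`-vector space basis such that for all `b, b′ ∈ B`, either `b * b′ = 0` or
`b * b′ ∈ B`), then `K′ = K`, i.e. the inclusion `K′ → K` is surjective. -/
theorem field_ext_multiplicative_basis_trivial
    (K' K : Type*) [Field K'] [Field K] [Algebra K' K]
    (B : Set K)
    (hli : LinearIndependent K' ((↑) : B → K))
    (hsp : Submodule.span K' B = ⊤)
    (hmul : ∀ b ∈ B, ∀ b' ∈ B, b * b' = 0 ∨ b * b' ∈ B) :
    Function.Surjective (algebraMap K' K) := by
  have hB0 : ∀ b ∈ B, b ≠ 0 := fun b hb => hli.ne_zero ⟨b, hb⟩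
  have hmem : ∀ b ∈ B, ∀ b' ∈ B, b * b' ∈ B := fun b hb b' hb' =>
    (hmul b hb b' hb').resolve_left (mul_ne_zero (hB0 b hb) (hB0 b' hb'))
  let bas : Module.Basis B K' K := Module.Basis.mk hli (by simp [hsp])
  -- the augmentation map, sending every basis element to `1`
  let ε : K →ₗ[K'] K' := bas.constr K' fun _ => (1 : K')
  have hε : ∀ b ∈ B, ε b = 1 := fun b hb => by
    have h := bas.constr_basis K' (fun _ => (1 : K')) ⟨b, hb⟩
    rwa [Module.Basis.mk_apply] at h
  have hεmul : ∀ x y, ε (x * y) = ε x * ε y := by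
    intro x y
    have hx : x ∈ Submodule.span K' B := hsp ▸ Submodule.mem_top
    have hy : y ∈ Submodule.span K' B := hsp ▸ Submodule.mem_top
    induction hx, hy using Submodule.span_induction₂ with
    | mem_mem b b' hb hb' => rw [hε _ (hmem b hb b' hb'), hε b hb, hε b' hb', one_mul]
    | zero_left y hy => simp
    | zero_right x hx => simp
    | add_left x y z _ _ _ h₁ h₂ => rw [add_mul, map_add, map_add, h₁, h₂, add_mul]
    | add_right x y z _ _ _ h₁ h₂ => rw [mul_add, map_add, map_add, h₁, h₂, mul_add]
    | smul_left r x y _ _ h => simp [h, mul_assoc]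
    | smul_right r x y _ _ h => simp [h, mul_left_comm]
  obtain ⟨b, hb⟩ : B.Nonempty := by
    rw [Set.nonempty_iff_ne_empty]
    rintro rfl
    rw [Submodule.span_empty] at hsp
    exact bot_ne_top hsp
  have hε1 : ε 1 = 1 := by simpa [hε b hb] using (hεmul 1 b).symm
  have hker : ∀ x, ε x = 0 → x = 0 := by
    intro x hx
    by_contra hne
    have h := hεmul x x⁻¹
    rw [mul_inv_cancel₀ hne, hε1, hx, zero_mul] at h
    exact one_ne_zero h
  intro x
  refine ⟨ε x, (sub_eq_zero.mp (hker _ ?_)).symm⟩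
  rw [Algebra.algebraMap_eq_smul_one, map_sub, map_smul, hε1, smul_eq_mul, mul_one, sub_self]
end

section
/- Let K be a field, 0 < n < ω, and (R_i)_{i<n} a finite family of K-algebras. Assume R_0 possesses a strong multiplicative K-basis B_0 containing a non-zero idempotent, and each R_i for 0 < i < n possesses a multiplicative K-basis. Then the product K-algebra R = ∏_{i<n} R_i possesses a strong multiplicative K-basis. -/
/-- If `N` is a linear endomorphism with `N ∘ N = 0`, then `1 + N` is invertible. -/
def LinearEquiv.oneAddOfSqZero {K M : Type*} [Ring K] [AddCommGroup M] [Module K M]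
    (N : M →ₗ[K] M) (hN : ∀ x, N (N x) = 0) : M ≃ₗ[K] M :=
  LinearEquiv.ofLinearMap (LinearMap.id + N) (LinearMap.id - N)
    (by ext x; simp [hN]) (by ext x; simp [hN])

/-- Adding a fixed element `e` of the basis of the factor `i₀` to all basis elements of the other
factors turns the standard basis of a finite product into another basis. -/
theorem Pi.exists_basis_single_add {K ι : Type*} [Field K] [Fintype ι] [DecidableEq ι]
    {A : ι → Type*}
    [∀ i, AddCommGroup (A i)] [∀ i, Module K (A i)] {κ : ι → Type*}
    (b : ∀ i, Module.Basis (κ i) K (A i)) (i₀ : ι) (e : κ i₀) :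
    ∃ c : Module.Basis (Σ i, κ i) K (∀ i, A i), ∀ i k,
      c ⟨i, k⟩ = Pi.single i (b i k) + if i = i₀ then 0 else Pi.single i₀ (b i₀ e) := by
  let s := Pi.basis b
  have hs : ∀ i k, s ⟨i, k⟩ = Pi.single i (b i k) := fun i k => by
    simp [s, Pi.basis_apply]
  let N : (∀ i, A i) →ₗ[K] (∀ i, A i) :=
    s.constr K fun p => if p.1 = i₀ then 0 else Pi.single i₀ (b i₀ e)
  have hNs : ∀ p, N (s p) = if p.1 = i₀ then 0 else Pi.single i₀ (b i₀ e) := fun p =>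
    s.constr_basis K _ p
  have hN : N ∘ₗ N = 0 := s.ext fun p => by
    rw [LinearMap.comp_apply, hNs]
    split_ifs
    · simp
    · rw [← hs, hNs]
      simp
  refine ⟨s.map (LinearEquiv.oneAddOfSqZero N fun x => LinearMap.congr_fun hN x), fun i k => ?_⟩
  rw [Module.Basis.map_apply]
  change s ⟨i, k⟩ + N (s ⟨i, k⟩) = _
  rw [hNs, hs]

theorem Pi.single_mul_single_of_ne {ι : Type*} [DecidableEq ι] {A : ι → Type*}
    [∀ i, MulZeroClass (A i)] {i j : ι} (h : i ≠ j) (x : A i) (y : A j) :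
    (Pi.single i x * Pi.single j y : ∀ i, A i) = 0 := by
  ext k
  rcases eq_or_ne k i with rfl | hk
  · simp [h]
  · simp [hk]

/-- If one factor of a finite product of algebras has a basis closed under multiplication that
contains an idempotent, and every other factor has a basis closed under multiplication up to zero,
then the product has a basis closed under multiplication. -/
theorem Pi.exists_strong_multiplicative_basis {K ι : Type*} [Field K] [Fintype ι] {A : ι → Type*}
    [∀ i, Ring (A i)] [∀ i, Algebra K (A i)] (i₀ : ι) (B₀ : Set (A i₀))
    (hli₀ : LinearIndependent K ((↑) : B₀ → A i₀)) (hsp₀ : Submodule.span K B₀ = ⊤)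
    (hB₀ : ∀ b ∈ B₀, ∀ b' ∈ B₀, b * b' ∈ B₀) (hidem : ∃ e ∈ B₀, IsIdempotentElem e)
    (hrest : ∀ i, i ≠ i₀ → ∃ B : Set (A i),
      LinearIndependent K ((↑) : B → A i) ∧ Submodule.span K B = ⊤ ∧
        ∀ b ∈ B, ∀ b' ∈ B, b * b' = 0 ∨ b * b' ∈ B) :
    ∃ B : Set (∀ i, A i),
      LinearIndependent K ((↑) : B → ∀ i, A i) ∧ Submodule.span K B = ⊤ ∧
        ∀ b ∈ B, ∀ b' ∈ B, b * b' ∈ B := by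
  classical
  have key : ∀ i, ∃ B : Set (A i), LinearIndependent K ((↑) : B → A i) ∧
      Submodule.span K B = ⊤ ∧ (∀ b ∈ B, ∀ b' ∈ B, b * b' = 0 ∨ b * b' ∈ B) ∧
      (i = i₀ → (∀ b ∈ B, ∀ b' ∈ B, b * b' ∈ B) ∧ ∃ e ∈ B, e * e = e) := by
    intro i
    by_cases h : i = i₀
    · subst h
      obtain ⟨e, he, hee⟩ := hidem
      exact ⟨B₀, hli₀, hsp₀, fun b hb b' hb' => .inr (hB₀ b hb b' hb'),
        fun _ => ⟨hB₀, e, he, hee⟩⟩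
    · obtain ⟨B, hli, hsp, hmul⟩ := hrest i h
      exact ⟨B, hli, hsp, hmul, fun h' => absurd h' h⟩
  choose B hli hsp hmul hB using key
  obtain ⟨hstrong, e, he, hee⟩ := hB i₀ rfl
  let b : ∀ i, Module.Basis (B i) K (A i) := fun i =>
    Module.Basis.mk (hli i) (by rw [Subtype.range_coe, hsp])
  have hb : ∀ i k, b i k = k := fun i k => by simp [b]
  obtain ⟨c, hc⟩ := Pi.exists_basis_single_add b i₀ ⟨e, he⟩
  have hc₀ : ∀ x (hx : x ∈ B i₀), c ⟨i₀, x, hx⟩ = Pi.single i₀ x := fun x hx => by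
    simp [hc, hb]
  have hc₁ : ∀ i, i ≠ i₀ → ∀ x (hx : x ∈ B i),
      c ⟨i, x, hx⟩ = Pi.single i x + Pi.single i₀ e := fun i hi x hx => by
    simp [hc, hb, hi]
  have mem₀ : ∀ x ∈ B i₀, Pi.single i₀ x ∈ Set.range c := fun x hx => ⟨_, hc₀ x hx⟩
  refine ⟨Set.range c, c.linearIndependent.linearIndepOn_id, c.span_eq, ?_⟩
  rintro _ ⟨⟨i, x, hx⟩, rfl⟩ _ ⟨⟨j, y, hy⟩, rfl⟩
  by_cases hi : i = i₀ <;> by_cases hj : j = i₀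
  · subst hi
    subst hj
    rw [hc₀, hc₀, ← Pi.single_mul]
    exact mem₀ _ (hstrong x hx y hy)
  · subst hi
    rw [hc₀, hc₁ j hj, mul_add, Pi.single_mul_single_of_ne (Ne.symm hj), zero_add,
      ← Pi.single_mul]
    exact mem₀ _ (hstrong x hx e he)
  · subst hj
    rw [hc₀, hc₁ i hi, add_mul, Pi.single_mul_single_of_ne hi, zero_add, ← Pi.single_mul]
    exact mem₀ _ (hstrong e he y hy)
  · rw [hc₁ i hi, hc₁ j hj, add_mul, mul_add, mul_add, Pi.single_mul_single_of_ne hi,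
      Pi.single_mul_single_of_ne (Ne.symm hj), add_zero, zero_add, ← Pi.single_mul i₀, hee]
    by_cases hij : i = j
    · subst hij
      rw [← Pi.single_mul]
      rcases hmul i x hx y hy with h | h
      · rw [h, Pi.single_zero, zero_add]
        exact mem₀ e he
      · exact ⟨_, hc₁ i hi _ h⟩
    · rw [Pi.single_mul_single_of_ne hij, zero_add]
      exact mem₀ e he

/-- Let `K` be a field, `0 < n < ω`, and `(R_i)_{i<n}` a finite family of
`K`-algebras. Assume `R_0` possesses a strong multiplicative `K`-basis containing a
non-zero idempotent, and each `R_i` for `0 < i < n` possesses a multiplicative `K`-basis.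
Then `R = ∏_{i<n} R_i` possesses a strong multiplicative `K`-basis. -/
theorem prod_strong_multiplicative_basis
    (K : Type*) [Field K] (n : ℕ) (hn : 0 < n) (A : Fin n → Type*)
    [∀ i, Ring (A i)] [∀ i, Algebra K (A i)]
    (B0 : Set (A ⟨0, hn⟩))
    (hB0li : LinearIndependent K ((↑) : B0 → A ⟨0, hn⟩))
    (hB0sp : Submodule.span K B0 = ⊤)
    (hB0strong : ∀ b ∈ B0, ∀ b' ∈ B0, b * b' ∈ B0)
    (hB0idem : ∃ e ∈ B0, e ≠ 0 ∧ IsIdempotentElem e)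
    (hrest : ∀ i : Fin n, i ≠ ⟨0, hn⟩ → ∃ B : Set (A i),
      LinearIndependent K ((↑) : B → A i) ∧ Submodule.span K B = ⊤ ∧
        ∀ b ∈ B, ∀ b' ∈ B, b * b' = 0 ∨ b * b' ∈ B) :
    ∃ B : Set (∀ i, A i),
      LinearIndependent K ((↑) : B → ∀ i, A i) ∧ Submodule.span K B = ⊤ ∧
        ∀ b ∈ B, ∀ b' ∈ B, b * b' ∈ B := by
  obtain ⟨e, he, -, hee⟩ := hB0idem
  exact Pi.exists_strong_multiplicative_basis ⟨0, hn⟩ B0 hB0li hB0sp hB0strong ⟨e, he, hee⟩ hrest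
end

section
/- Let K be a field and n ≥ 2 a natural number. Then the full matrix algebra M_n(K) possesses a multiplicative K-basis (the matrix units e_{ij}, i, j < n), but it possesses no strong multiplicative K-basis. -/
/-- The linear functional taking the value `1` on a basis closed under multiplication is
multiplicative. -/
theorem exists_nonUnitalAlgHom_eq_one_of_mul_mem {K A : Type*} [CommRing K]
    [NonUnitalRing A] [Module K A] [IsScalarTower K A A] [SMulCommClass K A A] {B : Set A}
    (hli : LinearIndependent K ((↑) : B → A)) (hsp : Submodule.span K B = ⊤)
    (hmul : ∀ b ∈ B, ∀ b' ∈ B, b * b' ∈ B) :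
    ∃ f : A →ₙₐ[K] K, ∀ b ∈ B, f b = 1 := by
  let e : Module.Basis B K A := Module.Basis.mk hli (by simp [hsp])
  let f : A →ₗ[K] K := e.constr K fun _ => 1
  have hf : ∀ b ∈ B, f b = 1 := fun b hb => by
    have h := e.constr_basis K (fun _ => (1 : K)) ⟨b, hb⟩
    rwa [Module.Basis.mk_apply] at h
  have hfm : (LinearMap.mul K A).compr₂ f = (LinearMap.mul K K).compl₁₂ f f := by
    refine e.ext fun b => e.ext fun b' => ?_
    simp [e, Module.Basis.mk_apply, hf _ b.2, hf _ b'.2, hf _ (hmul _ b.2 _ b'.2)]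
  exact ⟨{ f with
    map_zero' := map_zero f
    map_mul' := fun x y => LinearMap.congr_fun₂ hfm x y }, hf⟩

/-- Matrices over a nontrivial index type admit no nonzero multiplicative linear functional. -/
theorem Matrix.nonUnitalAlgHom_apply_eq_zero {K ι : Type*} [CommRing K] [IsReduced K]
    [Fintype ι] [DecidableEq ι] [Nontrivial ι] (f : Matrix ι ι K →ₙₐ[K] K)
    (M : Matrix ι ι K) : f M = 0 := by
  have hoff : ∀ i k : ι, k ≠ i → f (Matrix.single i k 1) = 0 := fun i k h => by
    refine (pow_eq_zero_iff two_ne_zero).1 ?_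
    rw [sq, ← map_mul]
    simp [h]
  have hsingle : ∀ i j : ι, f (Matrix.single i j 1) = 0 := fun i j => by
    obtain ⟨k, hk⟩ := exists_ne i
    rw [← one_mul (1 : K), ← Matrix.single_mul_single_same (i := i) (j := k) (k := j), map_mul, hoff i k hk, zero_mul]
  have hf : (f : Matrix ι ι K →ₗ[K] K) = 0 :=
    (Matrix.stdBasis K ι ι).ext fun ⟨i, j⟩ => by
      simpa [Matrix.stdBasis_eq_single] using hsingle i j
  exact LinearMap.congr_fun hf M

/-- The matrix units form a multiplicative basis. -/
theorem Matrix.range_stdBasis_mul {K ι : Type*} [Semiring K] [Fintype ι] [DecidableEq ι] :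
    ∀ b ∈ Set.range (Matrix.stdBasis K ι ι), ∀ b' ∈ Set.range (Matrix.stdBasis K ι ι),
      b * b' = 0 ∨ b * b' ∈ Set.range (Matrix.stdBasis K ι ι) := by
  rintro _ ⟨⟨i, j⟩, rfl⟩ _ ⟨⟨k, l⟩, rfl⟩
  by_cases h : j = k
  · subst h
    exact Or.inr ⟨(i, l), by simp [Matrix.stdBasis_eq_single]⟩
  · exact Or.inl (by simp [Matrix.stdBasis_eq_single, h])


/-- Let `K` be a field and `n ≥ 2`. Then the full matrix algebra
`M_n(K)` possesses a multiplicative `K`-basis, but possesses no strong multiplicative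
`K`-basis. -/
theorem matrix_multiplicative_basis_not_strong
    (K : Type*) [Field K] (n : ℕ) (hn : 2 ≤ n) :
    (∃ B : Set (Matrix (Fin n) (Fin n) K),
        LinearIndependent K ((↑) : B → Matrix (Fin n) (Fin n) K) ∧
          Submodule.span K B = ⊤ ∧
            ∀ b ∈ B, ∀ b' ∈ B, b * b' = 0 ∨ b * b' ∈ B) ∧
      (¬ ∃ B : Set (Matrix (Fin n) (Fin n) K),
        LinearIndependent K ((↑) : B → Matrix (Fin n) (Fin n) K) ∧
          Submodule.span K B = ⊤ ∧
            ∀ b ∈ B, ∀ b' ∈ B, b * b' ∈ B) := by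
  refine ⟨⟨Set.range (Matrix.stdBasis K (Fin n) (Fin n)),
    (Matrix.stdBasis K (Fin n) (Fin n)).linearIndependent.linearIndepOn_id,
    (Matrix.stdBasis K (Fin n) (Fin n)).span_eq, Matrix.range_stdBasis_mul⟩, ?_⟩
  rintro ⟨B, hli, hsp, hmul⟩
  have : Nontrivial (Fin n) := Fin.nontrivial_iff_two_le.2 hn
  obtain ⟨f, hf⟩ := exists_nonUnitalAlgHom_eq_one_of_mul_mem hli hsp hmul
  obtain ⟨b, hb⟩ : B.Nonempty := by
    rw [Set.nonempty_iff_ne_empty]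
    rintro rfl
    exact bot_ne_top (Submodule.span_empty.symm.trans hsp)
  exact zero_ne_one ((Matrix.nonUnitalAlgHom_apply_eq_zero f b).symm.trans (hf b hb))
end

section
/- Let K be a field, κ an infinite cardinal, and (R_α)_{α<κ} a family of K-algebras each of which possesses a multiplicative K-basis. Then the K-algebra R(κ,K,𝓡) possesses a multiplicative K-basis. If moreover R_0 possesses a strong multiplicative K-basis containing a non-zero idempotent, then R(κ,K,𝓡) possesses a strong multiplicative K-basis. -/
/-- The `K`-subalgebra `R(A,K,𝓡)` of `∏ i, R i`: all `p` such that for some `c ∈ K`,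
`p i = c • 1` for all but finitely many `i`. -/
def Rfam (K : Type*) [CommSemiring K] {ι : Type*} (A : ι → Type*) [∀ i, Semiring (A i)]
    [∀ i, Algebra K (A i)] : Subalgebra K (∀ i, A i) where
  carrier := {p | ∃ c : K, {i | p i ≠ algebraMap K (A i) c}.Finite}
  mul_mem' := by
    rintro p q ⟨c, hc⟩ ⟨d, hd⟩
    refine ⟨c * d, (hc.union hd).subset fun i hi => ?_⟩
    by_contra h
    simp only [Set.mem_union, Set.mem_setOf_eq, not_or, not_not] at h
    exact hi (show (p * q) i = _ by rw [Pi.mul_apply, h.1, h.2, map_mul])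
  add_mem' := by
    rintro p q ⟨c, hc⟩ ⟨d, hd⟩
    refine ⟨c + d, (hc.union hd).subset fun i hi => ?_⟩
    by_contra h
    simp only [Set.mem_union, Set.mem_setOf_eq, not_or, not_not] at h
    exact hi (show (p + q) i = _ by rw [Pi.add_apply, h.1, h.2, map_add])
  algebraMap_mem' := fun c => ⟨c, by simp⟩

section Helpers

variable {K : Type*} [Field K]

theorem exists_basis_subset_insert_one {R : Type*} [Ring R] [Algebra K R] {S : Set R}
    (hS : LinearIndependent K ((↑) : S → R)) (hspan : Submodule.span K (insert 1 S) = ⊤) :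
    ∃ B : Set R, S ⊆ B ∧ B ⊆ insert 1 S ∧ LinearIndependent K ((↑) : B → R) ∧
      Submodule.span K B = ⊤ := by
  obtain ⟨B, hB, hSB, hBspan, hBli⟩ :=
    exists_linearIndepOn_id_extension (K := K) hS (Set.subset_insert 1 S)
  refine ⟨B, hSB, hB, hBli, top_unique ?_⟩
  rw [← hspan]
  exact Submodule.span_le.2 hBspan

variable {ι : Type*} {A : ι → Type*} [∀ i, Ring (A i)] [∀ i, Algebra K (A i)]

open Classical in
/-- The inclusion of the `i`-th factor into `Rfam K A`. -/
noncomputable def Rfam.single (K : Type*) [Field K] {ι : Type*} (A : ι → Type*)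
    [∀ i, Ring (A i)] [∀ i, Algebra K (A i)] (i : ι) : A i →ₗ[K] Rfam K A :=
  (LinearMap.single K A i).codRestrict (Subalgebra.toSubmodule (Rfam K A)) fun a =>
    ⟨0, (Set.finite_singleton i).subset fun j hj => by
      by_contra h
      exact hj (by simp [Pi.single_eq_of_ne (show j ≠ i from h)])⟩

open Classical in
theorem Rfam.coe_single (i : ι) (a : A i) :
    (Rfam.single K A i a : ∀ i, A i) = Pi.single i a := rfl

theorem Rfam.single_mul_single_same (i : ι) (a b : A i) :
    Rfam.single K A i a * Rfam.single K A i b = Rfam.single K A i (a * b) := by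
  classical
  apply Subtype.ext
  simp only [MulMemClass.coe_mul, Rfam.coe_single, Pi.single_mul]

theorem Rfam.single_mul_single_of_ne {i j : ι} (h : i ≠ j) (a : A i) (b : A j) :
    Rfam.single K A i a * Rfam.single K A j b = 0 := by
  classical
  apply Subtype.ext
  ext k
  simp only [MulMemClass.coe_mul, Rfam.coe_single, Pi.mul_apply, ZeroMemClass.coe_zero,
    Pi.zero_apply]
  by_cases hk : k = i
  · subst hk
    rw [Pi.single_eq_of_ne h, mul_zero]
  · rw [Pi.single_eq_of_ne hk, zero_mul]

/-- `Rfam K A` is spanned by `1` and the images of its factors. -/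
theorem Rfam.submodule_eq_top {W : Submodule K (Rfam K A)}
    (h1 : (1 : Rfam K A) ∈ W) (hW : ∀ i a, Rfam.single K A i a ∈ W) : W = ⊤ := by
  classical
  refine Submodule.eq_top_iff'.2 fun p => ?_
  obtain ⟨c, hc⟩ := p.2
  have hp : p = c • (1 : Rfam K A) +
      ∑ i ∈ hc.toFinset, Rfam.single K A i ((p : ∀ i, A i) i - algebraMap K (A i) c) := by
    apply Subtype.ext
    ext j
    simp only [AddMemClass.coe_add, AddSubmonoidClass.coe_finsetSum, Rfam.coe_single,
      Pi.add_apply, Finset.sum_apply, Finset.sum_pi_single]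
    have hone : ((c • (1 : Rfam K A) : Rfam K A) : ∀ i, A i) j = algebraMap K (A j) c := by
      rw [Algebra.algebraMap_eq_smul_one]
      rfl
    rw [hone]
    split_ifs with h
    · abel
    · simpa using h
  rw [hp]
  exact W.add_mem (W.smul_mem c h1) (W.sum_mem fun i _ => hW i _)

variable {B : ∀ i, Set (A i)}

theorem Rfam.linearIndependent_single
    (hli : ∀ i, LinearIndependent K ((↑) : B i → A i)) :
    LinearIndependent K fun x : Σ i, B i => Rfam.single K A x.1 (x.2 : A x.1) := by
  classical
  have h := Pi.linearIndependent_single (fun i (b : B i) => (b : A i)) hli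
  exact LinearIndependent.of_comp (v := fun x : Σ i, B i => Rfam.single K A x.1 (x.2 : A x.1))
    (Rfam K A).val.toLinearMap h

theorem Rfam.span_insert_one_eq_top (hspan : ∀ i, Submodule.span K (B i) = ⊤)
    {S : Set (Rfam K A)}
    (hS : ∀ i, ∀ b ∈ B i, Rfam.single K A i b ∈ Submodule.span K S) :
    Submodule.span K (insert 1 S) = ⊤ := by
  refine Rfam.submodule_eq_top
    (Submodule.subset_span (Set.mem_insert 1 S)) fun i a => ?_
  have hle : Submodule.span K (B i) ≤
      (Submodule.span K (insert 1 S)).comap (Rfam.single K A i) :=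
    Submodule.span_le.2 fun b hb => Submodule.span_mono (Set.subset_insert 1 S) (hS i b hb)
  exact hle (hspan i ▸ Submodule.mem_top)

theorem Rfam.exists_multiplicative_basis
    (hli : ∀ i, LinearIndependent K ((↑) : B i → A i))
    (hspan : ∀ i, Submodule.span K (B i) = ⊤)
    (hmul : ∀ i, ∀ b ∈ B i, ∀ b' ∈ B i, b * b' = 0 ∨ b * b' ∈ B i) :
    ∃ C : Set (Rfam K A),
      LinearIndependent K ((↑) : C → Rfam K A) ∧ Submodule.span K C = ⊤ ∧
        ∀ b ∈ C, ∀ b' ∈ C, b * b' = 0 ∨ b * b' ∈ C := by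
  obtain ⟨C, hSC, hCS, hCli, hCspan⟩ := exists_basis_subset_insert_one
    (Rfam.linearIndependent_single hli).linearIndepOn_id
    (Rfam.span_insert_one_eq_top hspan fun i b hb => Submodule.subset_span ⟨⟨i, b, hb⟩, rfl⟩)
  refine ⟨C, hCli, hCspan, fun b hb b' hb' => ?_⟩
  rcases hCS hb with rfl | ⟨⟨i, a, ha⟩, rfl⟩
  · exact .inr (by rwa [one_mul])
  rcases hCS hb' with rfl | ⟨⟨j, a', ha'⟩, rfl⟩
  · exact .inr (by rwa [mul_one])
  by_cases hij : i = j
  · subst hij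
    dsimp only
    rw [Rfam.single_mul_single_same]
    rcases hmul i a ha a' ha' with h | h
    · exact .inl (by rw [h, map_zero])
    · exact .inr (hSC ⟨⟨i, _, h⟩, rfl⟩)
  · exact .inl (Rfam.single_mul_single_of_ne hij a a')

theorem Rfam.exists_strong_multiplicative_basis
    (hli : ∀ i, LinearIndependent K ((↑) : B i → A i))
    (hspan : ∀ i, Submodule.span K (B i) = ⊤)
    (hmul : ∀ i, ∀ b ∈ B i, ∀ b' ∈ B i, b * b' = 0 ∨ b * b' ∈ B i)
    {i₀ : ι} (hmul₀ : ∀ b ∈ B i₀, ∀ b' ∈ B i₀, b * b' ∈ B i₀)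
    {e : A i₀} (he : e ∈ B i₀) (hee : IsIdempotentElem e) :
    ∃ C : Set (Rfam K A),
      LinearIndependent K ((↑) : C → Rfam K A) ∧ Submodule.span K C = ⊤ ∧
        ∀ b ∈ C, ∀ b' ∈ C, b * b' ∈ C := by
  classical
  let w : (Σ i, B i) → Rfam K A := fun x => Rfam.single K A x.1 (x.2 : A x.1)
  let c : (Σ i, B i) → K := fun x => if x.1 = i₀ then 0 else 1
  let x₀ : Σ i, B i := ⟨i₀, e, he⟩
  let v : (Σ i, B i) → Rfam K A := w + (c · • w x₀)
  have hvli : LinearIndependent K v :=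
    (linearIndependent_add_smul_iff (v := w) (c := c) (i := x₀) (if_pos rfl)).2
      (Rfam.linearIndependent_single hli)
  have hv₀ (b : A i₀) (hb : b ∈ B i₀) : v ⟨i₀, b, hb⟩ = Rfam.single K A i₀ b := by
    simp [v, w, c]
  have hv₁ {i : ι} (hi : i ≠ i₀) (b : A i) (hb : b ∈ B i) :
      v ⟨i, b, hb⟩ = Rfam.single K A i b + Rfam.single K A i₀ e := by
    simp [v, w, c, x₀, hi]
  have hmem₀ (b : A i₀) (hb : b ∈ B i₀) : Rfam.single K A i₀ b ∈ Set.range v :=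
    ⟨_, hv₀ b hb⟩
  have hvspan : ∀ i, ∀ b ∈ B i, Rfam.single K A i b ∈ Submodule.span K (Set.range v) := by
    intro i b hb
    by_cases hi : i = i₀
    · subst hi
      exact Submodule.subset_span (hmem₀ b hb)
    · rw [eq_sub_of_add_eq (hv₁ hi b hb).symm]
      exact sub_mem (Submodule.subset_span ⟨_, rfl⟩) (Submodule.subset_span (hmem₀ e he))
  have hvmul : ∀ x y, v x * v y ∈ Set.range v := by
    rintro ⟨i, a, ha⟩ ⟨j, b, hb⟩
    by_cases hi : i = i₀
    · subst hi
      by_cases hj : j = i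
      · subst hj
        rw [hv₀, hv₀, Rfam.single_mul_single_same]
        exact hmem₀ _ (hmul₀ a ha b hb)
      · rw [hv₀, hv₁ hj, mul_add, Rfam.single_mul_single_of_ne (Ne.symm hj), zero_add,
          Rfam.single_mul_single_same]
        exact hmem₀ _ (hmul₀ a ha e he)
    · by_cases hj : j = i₀
      · subst hj
        rw [hv₁ hi, hv₀, add_mul, Rfam.single_mul_single_of_ne hi, zero_add,
          Rfam.single_mul_single_same]
        exact hmem₀ _ (hmul₀ e he b hb)
      · rw [hv₁ hi, hv₁ hj, add_mul, mul_add, mul_add, Rfam.single_mul_single_of_ne hi,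
          Rfam.single_mul_single_of_ne (Ne.symm hj), Rfam.single_mul_single_same, hee.eq,
          add_zero, zero_add]
        by_cases hij : i = j
        · subst hij
          rw [Rfam.single_mul_single_same]
          rcases hmul i a ha b hb with h | h
          · rw [h, map_zero, zero_add]
            exact hmem₀ e he
          · exact ⟨_, hv₁ hi _ h⟩
        · rw [Rfam.single_mul_single_of_ne hij, zero_add]
          exact hmem₀ e he
  obtain ⟨C, hSC, hCS, hCli, hCspan⟩ := exists_basis_subset_insert_one
    hvli.linearIndepOn_id (Rfam.span_insert_one_eq_top hspan hvspan)
  refine ⟨C, hCli, hCspan, fun b hb b' hb' => ?_⟩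
  rcases hCS hb with rfl | ⟨x, rfl⟩
  · rwa [one_mul]
  rcases hCS hb' with rfl | ⟨y, rfl⟩
  · rwa [mul_one]
  exact hSC (hvmul x y)

end Helpers

set_option synthInstance.maxHeartbeats 1000000 in
set_option maxHeartbeats 2000000 in
/-- Let `K` be a field, `κ` an infinite cardinal (here an infinite index
type `ι`), and `(R_α)_{α<κ}` a family of `K`-algebras each of which possesses a
multiplicative `K`-basis. Then `R(κ,K,𝓡)` possesses a multiplicative `K`-basis; and if
moreover some member `R_{i₀}` of the family possesses a strong multiplicative `K`-basis
containing a non-zero idempotent, then `R(κ,K,𝓡)` possesses a strong multiplicative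
`K`-basis. -/
theorem Rfam_multiplicative_basis
    (K : Type*) [Field K] {ι : Type*} [Infinite ι] (A : ι → Type*)
    [∀ i, Ring (A i)] [∀ i, Algebra K (A i)]
    (hmult : ∀ i : ι, ∃ B : Set (A i),
      LinearIndependent K ((↑) : B → A i) ∧ Submodule.span K B = ⊤ ∧
        ∀ b ∈ B, ∀ b' ∈ B, b * b' = 0 ∨ b * b' ∈ B) :
    (∃ B : Set (Rfam K A),
        LinearIndependent K ((↑) : B → Rfam K A) ∧ Submodule.span K B = ⊤ ∧
          ∀ b ∈ B, ∀ b' ∈ B, b * b' = 0 ∨ b * b' ∈ B) ∧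
      (∀ i₀ : ι, (∃ B₀ : Set (A i₀),
          LinearIndependent K ((↑) : B₀ → A i₀) ∧ Submodule.span K B₀ = ⊤ ∧
            (∀ b ∈ B₀, ∀ b' ∈ B₀, b * b' ∈ B₀) ∧
              ∃ e ∈ B₀, e ≠ 0 ∧ IsIdempotentElem e) →
        ∃ B : Set (Rfam K A),
          LinearIndependent K ((↑) : B → Rfam K A) ∧ Submodule.span K B = ⊤ ∧
            ∀ b ∈ B, ∀ b' ∈ B, b * b' ∈ B) := by
  choose B hli hspan hmul using hmult
  refine ⟨Rfam.exists_multiplicative_basis hli hspan hmul, ?_⟩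
  rintro i₀ ⟨B₀, hli₀, hspan₀, hmul₀, e, he, -, hee⟩
  classical
  have hne {i : ι} (hi : i ≠ i₀) : Function.update B i₀ B₀ i = B i := Function.update_of_ne hi _ _
  have heq : Function.update B i₀ B₀ i₀ = B₀ := Function.update_self _ _ _
  refine Rfam.exists_strong_multiplicative_basis (B := Function.update B i₀ B₀) (i₀ := i₀) (e := e)
    (fun i => ?_) (fun i => ?_) (fun i => ?_) (by rwa [heq]) (by rwa [heq]) hee
  all_goals
    by_cases hi : i = i₀
    · subst hi
      rw [heq]
      first | assumption | exact fun b hb b' hb' => .inr (hmul₀ b hb b' hb')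
    · rw [hne hi]
      first | exact hli i | exact hspan i | exact hmul i
end

section
/- Let K be a field, κ an infinite cardinal, and R = R(κ,K). Let I be an ideal of R that is not contained in the ideal K^{(κ)} of finitely supported functions. Then I is a finitely generated ideal and is a direct summand of R as an R-module (i.e. R = I ⊕ C for some ideal C of R). -/
open scoped Classical in
/-- The point indicators, as elements of `R(κ,K)`. -/
noncomputable def Rconst.delta (K : Type*) {ι : Type*} [Field K] (a : ι) : Rconst K ι :=
  ⟨Pi.single a 1, 0, (Set.finite_singleton a).subset fun b hb => by
    by_contra h
    exact hb (Pi.single_eq_of_ne h 1)⟩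

open scoped Classical in
/-- An ideal of `R(κ,K)` contains the indicator of every point where one of its members does
not vanish. -/
theorem Rconst.delta_mem {K ι : Type*} [Field K] {I : Ideal (Rconst K ι)} {y : Rconst K ι}
    (hy : y ∈ I) {a : ι} (ha : (y : ι → K) a ≠ 0) : Rconst.delta K a ∈ I := by
  have h : Rconst.delta K a =
      (algebraMap K (Rconst K ι) ((y : ι → K) a)⁻¹ * Rconst.delta K a) * y := by
    ext b
    change (Pi.single a 1 : ι → K) b =
      ((y : ι → K) a)⁻¹ * (Pi.single a 1 : ι → K) b * (y : ι → K) b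
    by_cases hb : b = a
    · subst hb
      simp [ha]
    · simp [hb]
  rw [h]
  exact I.mul_mem_left _ hy

open scoped Classical in
/-- A finitely supported function lies in an ideal of `R(κ,K)` as soon as each point of its
support lies in the support of some member of the ideal. -/
theorem Rconst.mem_of_finite_support {K ι : Type*} [Field K] {I : Ideal (Rconst K ι)}
    {z : Rconst K ι} (hz : {a | (z : ι → K) a ≠ 0}.Finite)
    (h : ∀ a, (z : ι → K) a ≠ 0 → ∃ y ∈ I, (y : ι → K) a ≠ 0) : z ∈ I := by
  have hsum : z = ∑ a ∈ hz.toFinset, z * Rconst.delta K a := by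
    ext b
    rw [AddSubmonoidClass.coe_finsetSum, Finset.sum_apply]
    change (z : ι → K) b = ∑ a ∈ hz.toFinset, (z : ι → K) b * (Pi.single a 1 : ι → K) b
    simp only [Pi.single_apply, mul_ite, mul_one, mul_zero, Finset.sum_ite_eq,
      Set.Finite.mem_toFinset, Set.mem_ofPred_eq]
    split_ifs with hb
    · rfl
    · exact not_not.mp hb
  rw [hsum]
  refine I.sum_mem fun a ha => I.mul_mem_left _ ?_
  obtain ⟨y, hy, hya⟩ := h a (hz.mem_toFinset.mp ha)
  exact Rconst.delta_mem hy hya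

open scoped Classical in
/-- An ideal of `R(κ,K)` with a member of infinite support contains an element acting as the
identity on it. -/
theorem Rconst.exists_mem_forall_mul_eq {K ι : Type*} [Field K] {I : Ideal (Rconst K ι)}
    {x : Rconst K ι} (hx : x ∈ I) (hinf : {a | (x : ι → K) a ≠ 0}.Infinite) :
    ∃ e ∈ I, ∀ y ∈ I, y * e = y := by
  obtain ⟨c, hc⟩ := x.2
  have hc0 : c ≠ 0 := by
    rintro rfl
    exact hinf hc
  let S : Set ι := {a | ∃ y ∈ I, (y : ι → K) a ≠ 0}
  have hxS : ∀ a, a ∉ S → (x : ι → K) a = 0 := fun a ha => by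
    by_contra h
    exact ha ⟨x, hx, h⟩
  let e : Rconst K ι := ⟨fun a => if a ∈ S then 1 else 0, 1, hc.subset fun a ha h => by
    refine ha (if_pos ⟨x, hx, ?_⟩)
    rw [h]
    exact hc0⟩
  have he : ∀ a, (e : ι → K) a = if a ∈ S then 1 else 0 := fun _ => rfl
  refine ⟨e, ?_, fun y hy => ?_⟩
  · have hval : ∀ a, ((e - algebraMap K (Rconst K ι) c⁻¹ * x : Rconst K ι) : ι → K) a =
        (if a ∈ S then 1 else 0) - c⁻¹ * (x : ι → K) a := fun _ => rfl
    rw [← sub_add_cancel e (algebraMap K (Rconst K ι) c⁻¹ * x)]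
    refine I.add_mem (Rconst.mem_of_finite_support ?_ ?_) (I.mul_mem_left _ hx)
    · refine hc.subset fun a ha h => ha ?_
      have haS : a ∈ S := ⟨x, hx, by rw [h]; exact hc0⟩
      rw [hval, if_pos haS, h, inv_mul_cancel₀ hc0, sub_self]
    · intro a ha
      change a ∈ S
      by_contra haS
      refine ha ?_
      rw [hval, if_neg haS, hxS a haS, mul_zero, sub_zero]
  · ext a
    change (y : ι → K) a * (e : ι → K) a = (y : ι → K) a
    rw [he]
    split_ifs with ha
    · exact mul_one _
    · rw [mul_zero]
      by_contra h
      exact ha ⟨y, hy, Ne.symm h⟩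

/-- An ideal of a commutative ring containing an identity element for itself is principal and
a direct summand. -/
theorem Ideal.fg_and_exists_isCompl_of_mul_eq {R : Type*} [CommRing R] {I : Ideal R} {e : R}
    (he : e ∈ I) (h : ∀ y ∈ I, y * e = y) : I.FG ∧ ∃ C : Ideal R, IsCompl I C := by
  have hI : Ideal.span {e} = I := le_antisymm ((Ideal.span_singleton_le_iff_mem I).mpr he)
    fun y hy => Ideal.mem_span_singleton'.mpr ⟨y, h y hy⟩
  refine ⟨⟨{e}, by simpa using hI⟩, Ideal.span {1 - e}, ?_, ?_⟩
  · rw [Submodule.disjoint_def]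
    intro y hy hy'
    obtain ⟨r, rfl⟩ := Ideal.mem_span_singleton'.mp hy'
    rw [← h _ hy, mul_assoc, sub_mul, one_mul, h e he, sub_self, mul_zero]
  · rw [codisjoint_iff, Ideal.eq_top_iff_one]
    exact Submodule.mem_sup.mpr
      ⟨e, he, 1 - e, Ideal.mem_span_singleton_self _, add_sub_cancel e 1⟩

/-- Let `K` be a field, `κ` an infinite cardinal (here an infinite
index type `ι`), and `R = R(κ,K)`. If `I` is an ideal of `R` not contained in the ideal
`K^{(κ)}` of finitely supported functions, then `I` is finitely generated and is a direct
summand of `R` as an `R`-module: `R = I ⊕ C` for some ideal `C`. -/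
theorem ideal_not_in_finSupp_is_summand
    (K ι : Type*) [Field K] [Infinite ι]
    (I : Ideal (Rconst K ι))
    (hI : ¬ ∀ x : Rconst K ι, x ∈ I → {a | (x : ι → K) a ≠ 0}.Finite) :
    I.FG ∧ ∃ C : Ideal (Rconst K ι), IsCompl I C := by
  push Not at hI
  obtain ⟨x, hx, hinf⟩ := hI
  obtain ⟨e, he, h⟩ := Rconst.exists_mem_forall_mul_eq hx hinf
  exact Ideal.fg_and_exists_isCompl_of_mul_eq he h
end

section
/- Let K be a field, κ an infinite cardinal, and R = R(κ,K). Then every ideal of R can be generated by at most κ elements, while the ideal K^{(κ)} of finitely supported functions cannot be generated by fewer than κ elements. Hence γ(R) = κ⁺, where γ(R) is the least infinite cardinal λ such that every ideal of R is generated by fewer than λ elements. -/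
set_option synthInstance.maxHeartbeats 1000000 in
set_option maxHeartbeats 2000000 in
/-- The ideal `K^{(κ)}` of `R(κ,K)` consisting of the finitely supported functions. -/
def finSuppIdeal (K ι : Type*) [Field K] : Ideal (Rconst K ι) where
  carrier := {x | {a | (x : ι → K) a ≠ 0}.Finite}
  add_mem' := by
    intro x y hx hy
    refine (hx.union hy).subset fun a ha => ?_
    by_contra h
    simp only [Set.mem_union, Set.mem_setOf_eq, not_or, not_not] at h
    exact ha (show ((x + y : Rconst K ι) : ι → K) a = 0 by
      simp only [Subalgebra.coe_add, Pi.add_apply, h.1, h.2, add_zero])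
  zero_mem' := by simp
  smul_mem' := by
    intro c x hx
    refine hx.subset fun a ha => ?_
    by_contra h
    simp only [Set.mem_setOf_eq, not_not] at h
    exact ha (show ((c • x : Rconst K ι) : ι → K) a = 0 by
      simp only [smul_eq_mul, Subalgebra.coe_mul, Pi.mul_apply, h, mul_zero])

universe u

/-- The indicator function of a finite set, as an element of `R(κ,K)`. -/
noncomputable def Rconst.indicator (K : Type*) {ι : Type*} [Field K] (s : Finset ι) :
    Rconst K ι :=
  ⟨(s : Set ι).indicator 1, 0, s.finite_toSet.subset fun a ha => by
    by_contra h
    exact ha (Set.indicator_of_notMem h _)⟩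

/-- The idempotents of `R(κ,K)`: indicators of finite sets and of cofinite sets. -/
noncomputable def Rconst.idem (K : Type*) {ι : Type*} [Field K] :
    Finset ι ⊕ Finset ι → Rconst K ι :=
  Sum.elim (Rconst.indicator K) (fun s => 1 - Rconst.indicator K s)

/-- The pointwise inverse (with `0⁻¹ = 0`) of an eventually constant function. -/
def Rconst.pinv {K ι : Type*} [Field K] (f : Rconst K ι) : Rconst K ι :=
  ⟨fun a => ((f : ι → K) a)⁻¹, by
    obtain ⟨c, hc⟩ := f.2
    refine ⟨c⁻¹, hc.subset fun a ha h => ha ?_⟩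
    simp only [h]⟩

theorem Rconst.mul_pinv_mem_range_idem {K ι : Type*} [Field K] (f : Rconst K ι) :
    f * Rconst.pinv f ∈ Set.range (Rconst.idem K (ι := ι)) := by
  obtain ⟨c, hc⟩ := f.2
  rcases eq_or_ne c 0 with rfl | hc0
  · refine ⟨Sum.inl hc.toFinset, Subtype.ext (funext fun a => ?_)⟩
    change (hc.toFinset : Set ι).indicator 1 a = (f : ι → K) a * ((f : ι → K) a)⁻¹
    by_cases h : (f : ι → K) a = 0 <;> simp [Set.indicator, h]
  · have hz : {a | (f : ι → K) a = 0}.Finite :=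
      hc.subset fun a ha h => hc0 (h.symm.trans ha)
    refine ⟨Sum.inr hz.toFinset, Subtype.ext (funext fun a => ?_)⟩
    change 1 - (hz.toFinset : Set ι).indicator 1 a = (f : ι → K) a * ((f : ι → K) a)⁻¹
    by_cases h : (f : ι → K) a = 0 <;> simp [Set.indicator, h]

theorem Rconst.mul_pinv_mul_self {K ι : Type*} [Field K] (f : Rconst K ι) :
    f * (f * Rconst.pinv f) = f := by
  refine Subtype.ext (funext fun a => ?_)
  change (f : ι → K) a * ((f : ι → K) a * ((f : ι → K) a)⁻¹) = (f : ι → K) a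
  by_cases h : (f : ι → K) a = 0 <;> simp [h]

theorem Rconst.span_inter_range_idem {K ι : Type*} [Field K] (I : Ideal (Rconst K ι)) :
    Ideal.span ((I : Set (Rconst K ι)) ∩ Set.range (Rconst.idem K)) = I := by
  refine le_antisymm (Ideal.span_le.2 Set.inter_subset_left) fun f hf => ?_
  rw [← Rconst.mul_pinv_mul_self f]
  exact Ideal.mul_mem_left _ _
    (Ideal.subset_span ⟨I.mul_mem_right _ hf, Rconst.mul_pinv_mem_range_idem f⟩)

theorem Rconst.exists_span_eq {K ι : Type u} [Field K] [Infinite ι]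
    (I : Ideal (Rconst K ι)) :
    ∃ S : Set (Rconst K ι), Cardinal.mk S ≤ Cardinal.mk ι ∧ Ideal.span S = I := by
  refine ⟨_, ?_, Rconst.span_inter_range_idem I⟩
  calc Cardinal.mk ↥((I : Set (Rconst K ι)) ∩ Set.range (Rconst.idem K))
      ≤ Cardinal.mk (Set.range (Rconst.idem K (ι := ι))) :=
        Cardinal.mk_le_mk_of_subset Set.inter_subset_right
    _ ≤ Cardinal.mk (Finset ι ⊕ Finset ι) := Cardinal.mk_range_le
    _ = Cardinal.mk ι := by
      rw [Cardinal.mk_sum, Cardinal.lift_id, Cardinal.mk_finset_of_infinite,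
        Cardinal.add_eq_self (Cardinal.aleph0_le_mk ι)]

/-- Evaluation at a point, as a ring homomorphism on `R(κ,K)`. -/
def Rconst.eval {K ι : Type*} [Field K] (a : ι) : Rconst K ι →+* K :=
  (Pi.evalRingHom (fun _ => K) a).comp (Rconst K ι).val.toRingHom

theorem Rconst.indicator_mem_finSuppIdeal {K ι : Type*} [Field K] (s : Finset ι) :
    Rconst.indicator K s ∈ finSuppIdeal K ι :=
  s.finite_toSet.subset fun _ ha => by
    by_contra h
    exact ha (Set.indicator_of_notMem h _)

theorem Rconst.exists_apply_ne_zero_of_span_eq {K ι : Type*} [Field K] {S : Set (Rconst K ι)}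
    (hS : Ideal.span S = finSuppIdeal K ι) (a : ι) : ∃ s : S, (s : Rconst K ι).1 a ≠ 0 := by
  by_contra! h
  have hle : finSuppIdeal K ι ≤ RingHom.ker (Rconst.eval (K := K) a) :=
    hS ▸ Ideal.span_le.2 fun s hs => h ⟨s, hs⟩
  have h0 : (({a} : Finset ι) : Set ι).indicator (1 : ι → K) a = 0 :=
    hle (Rconst.indicator_mem_finSuppIdeal {a})
  simp at h0

theorem Rconst.mk_le_of_span_eq_finSuppIdeal {K ι : Type u} [Field K] [Infinite ι]
    {S : Set (Rconst K ι)} (hS : Ideal.span S = finSuppIdeal K ι) :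
    Cardinal.mk ι ≤ Cardinal.mk S := by
  by_contra! hlt
  choose g hg using Rconst.exists_apply_ne_zero_of_span_eq hS
  obtain ⟨s, hs⟩ := Cardinal.exists_infinite_fiber g hlt
  have hmem : (s : Rconst K ι) ∈ finSuppIdeal K ι := hS ▸ Ideal.subset_span s.2
  have hfin : {a | (s : Rconst K ι).1 a ≠ 0}.Finite := hmem
  refine Set.infinite_coe_iff.1 hs (hfin.subset fun a ha => ?_)
  obtain rfl : g a = s := ha
  exact hg a

set_option synthInstance.maxHeartbeats 1000000 in
set_option maxHeartbeats 2000000 in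
/-- Let `K` be a field, `κ` an infinite cardinal (here `κ = #ι` for an
infinite index type `ι`), and `R = R(κ,K)`. Then every ideal of `R` is generated by at
most `κ` elements, the ideal `K^{(κ)}` of finitely supported functions is not generated by
fewer than `κ` elements, and hence `γ(R)`, the least infinite cardinal `λ` such that every
ideal of `R` is generated by fewer than `λ` elements, equals `κ⁺`. -/
theorem gamma_Rconst_eq_succ
    (K ι : Type u) [Field K] [Infinite ι] :
    (∀ I : Ideal (Rconst K ι), ∃ S : Set (Rconst K ι),
        Cardinal.mk S ≤ Cardinal.mk ι ∧ Ideal.span S = I) ∧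
      (¬ ∃ S : Set (Rconst K ι),
        Cardinal.mk S < Cardinal.mk ι ∧ Ideal.span S = finSuppIdeal K ι) ∧
      sInf {lam : Cardinal.{u} | Cardinal.aleph0 ≤ lam ∧
          ∀ I : Ideal (Rconst K ι), ∃ S : Set (Rconst K ι),
            Cardinal.mk S < lam ∧ Ideal.span S = I} =
        Order.succ (Cardinal.mk ι) := by
  refine ⟨Rconst.exists_span_eq, ?_, IsLeast.csInf_eq ⟨⟨?_, fun I => ?_⟩, ?_⟩⟩
  · rintro ⟨S, hlt, hS⟩
    exact hlt.not_ge (Rconst.mk_le_of_span_eq_finSuppIdeal hS)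
  · exact (Cardinal.aleph0_le_mk ι).trans (Order.le_succ _)
  · obtain ⟨S, hle, hS⟩ := Rconst.exists_span_eq I
    exact ⟨S, Order.lt_succ_of_le hle, hS⟩
  · rintro lam ⟨-, h⟩
    obtain ⟨S, hlt, hS⟩ := h (finSuppIdeal K ι)
    exact Order.succ_le_of_lt ((Rconst.mk_le_of_span_eq_finSuppIdeal hS).trans_lt hlt)
end

section
/- Let K be a field and κ an infinite cardinal. Then the product K^κ, regarded as a module over R = R(κ,K) via pointwise multiplication, is an injective R-module. -/
theorem Rconst.inv_mem {K ι : Type*} [Field K] {f : ι → K} (hf : f ∈ Rconst K ι) :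
    f⁻¹ ∈ Rconst K ι := by
  obtain ⟨c, hc⟩ := hf
  refine ⟨c⁻¹, hc.subset fun a ha h => ha ?_⟩
  rw [Pi.inv_apply, h]

set_option synthInstance.maxHeartbeats 1000000 in
/-- A linear map from an ideal of `R(κ,K)` to `K^κ` vanishes wherever its argument does,
since `R(κ,K)` is von Neumann regular. -/
theorem Rconst.apply_eq_zero {K ι : Type*} [Field K] {I : Ideal (Rconst K ι)}
    (g : I →ₗ[Rconst K ι] (ι → K)) (x : I) {a : ι} (hx : x.1.1 a = 0) : g x a = 0 := by
  let y : Rconst K ι := ⟨x.1.1⁻¹, Rconst.inv_mem x.1.2⟩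
  have hreg : (x.1 * y) • x = x := by
    refine Subtype.ext (Subtype.ext (funext fun b => ?_))
    exact mul_inv_mul_cancel (x.1.1 b)
  have hg : g x = (x.1 * y) • g x := by rw [← map_smul, hreg]
  have ha : g x a = (x.1.1 a * (x.1.1 a)⁻¹) * g x a := congrFun hg a
  rw [ha, hx, zero_mul, zero_mul]

set_option synthInstance.maxHeartbeats 1000000 in
theorem Rconst.apply_mul_apply {K ι : Type*} [Field K] {I : Ideal (Rconst K ι)}
    (g : I →ₗ[Rconst K ι] (ι → K)) (x y : I) (a : ι) :
    x.1.1 a * g y a = y.1.1 a * g x a := by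
  have hxy : x.1 • y = y.1 • x := Subtype.ext (mul_comm x.1 y.1)
  have hg : x.1 • g y = y.1 • g x := by rw [← map_smul, ← map_smul, hxy]
  exact congrFun hg a

theorem Rconst.exists_multiplier {K ι : Type*} [Field K] {I : Ideal (Rconst K ι)}
    (g : I →ₗ[Rconst K ι] (ι → K)) : ∃ h : ι → K, ∀ x : I, x.1 • h = g x := by
  have hpt : ∀ a, ∃ c : K, ∀ x : I, x.1.1 a * c = g x a := by
    intro a
    by_cases ha : ∃ r : I, r.1.1 a ≠ 0
    · obtain ⟨r, hr⟩ := ha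
      refine ⟨g r a / r.1.1 a, fun x => ?_⟩
      rw [← mul_div_assoc, Rconst.apply_mul_apply, mul_div_cancel_left₀ _ hr]
    · push Not at ha
      exact ⟨0, fun x => by rw [mul_zero, Rconst.apply_eq_zero g x (ha x)]⟩
  choose h hh using hpt
  exact ⟨h, fun x => funext fun a => hh a x⟩

set_option synthInstance.maxHeartbeats 1000000 in
/-- Let `K` be a field and `κ` an infinite cardinal (here an infinite
index type `ι`). Then `K^κ`, regarded as a module over `R = R(κ,K)` via pointwise
multiplication, is an injective `R`-module. -/
theorem pow_injective_over_Rconst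
    (K ι : Type u) [Field K] [Infinite ι] :
    Module.Injective (Rconst K ι) (ι → K) := by
  refine Module.Baer.injective fun I g => ?_
  obtain ⟨h, hh⟩ := Rconst.exists_multiplier g
  exact ⟨LinearMap.toSpanSingleton _ _ h, fun x hx => hh ⟨x, hx⟩⟩
end
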